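/- Let (X,d) be an (R,D)-thin metric space. Assume that X is non-compact and that X does not contain a line (there is no isometric map ℝ → X). Then there exists a ray r : [0,∞) → X whose 10R-neighbourhood contains X, i.e. dist(x, r([0,∞))) < 10R for every x ∈ X. -/

import Mathlib

open Metric Set

/-- `l` restricted to `[a, b]` is a unit-speed segment (isometric embedding of `[a,b]`). -/
def IsSegmentOn {X : Type*} [PseudoMetricSpace X] (l : ℝ → X) (a b : ℝ) : Prop :=
  ∀ s ∈ Set.Icc a b, ∀ t ∈ Set.Icc a b, dist (l s) (l t) = |s - t|

/-- A ray in `X`: an isometric embedding of `[0, ∞)`. -/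
def IsRay {X : Type*} [PseudoMetricSpace X] (r : ℝ → X) : Prop :=
  ∀ s t : ℝ, 0 ≤ s → 0 ≤ t → dist (r s) (r t) = |s - t|

/-- `X` is a geodesic space: any two points are joined by a segment. -/
def IsGeodesicSpace (X : Type*) [PseudoMetricSpace X] : Prop :=
  ∀ x y : X, ∃ f : ℝ → X, IsSegmentOn f 0 (dist x y) ∧ f 0 = x ∧ f (dist x y) = y

/-- The metric projection of a point `x` to a set `K`:
the set of points of `K` realizing the distance from `x` to `K`. -/
def metricProj {X : Type*} [PseudoMetricSpace X] (K : Set X) (x : X) : Set X :=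
  {y ∈ K | dist x y = Metric.infDist x K}

/-- The metric projection of a set `A` to a set `K`. -/
def metricProjSet {X : Type*} [PseudoMetricSpace X] (K A : Set X) : Set X :=
  ⋃ x ∈ A, metricProj K x

/-- `S` contains a `c`-net of `T`: every point of `T` is within distance `c` of `S`. -/
def ContainsNetOf {X : Type*} [PseudoMetricSpace X] (S T : Set X) (c : ℝ) : Prop :=
  ∀ p ∈ T, ∃ q ∈ S, dist p q ≤ c

/-- An `(R,D)`-thin metric space: a proper, separable, geodesic metric space
(with `R ≥ 20 D > 0`) such that for every segment `l` of length `L > 2R`, every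
`t ∈ (R, L - R)` and every `x` whose projection to `l` meets `l(t)`, one has
`dist(x, l) < D`. -/
structure IsThinSpace (X : Type*) [MetricSpace X] (R D : ℝ) : Prop where
  R_pos : 0 < R
  D_pos : 0 < D
  twentyD_le_R : 20 * D ≤ R
  proper : ProperSpace X
  separable : TopologicalSpace.SeparableSpace X
  geodesic : IsGeodesicSpace X
  thin : ∀ (l : ℝ → X) (L : ℝ), 2 * R < L → IsSegmentOn l 0 L →
    ∀ t ∈ Set.Ioo R (L - R), ∀ x : X,
      dist x (l t) = Metric.infDist x (l '' Set.Icc 0 L) →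
      Metric.infDist x (l '' Set.Icc 0 L) < D

open Filter Topology

/-- `r t` is a nearest point to `x` on the ray `r`. -/
def IsNearestOnRay {X : Type*} [PseudoMetricSpace X] (r : ℝ → X) (x : X) (t : ℝ) : Prop :=
  0 ≤ t ∧ ∀ s, 0 ≤ s → dist x (r t) ≤ dist x (r s)

/-- In a proper space, a sequence of pointwise bounded maps that are eventually isometric on each
pair of points of `S` has an ultralimit that is isometric on `S`. -/
theorem exists_isometric_ultralimit {X : Type*} [MetricSpace X] [ProperSpace X]
    (f : ℕ → ℝ → X) (o : X) (S : Set ℝ)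
    (hb : ∀ t ∈ S, ∃ C, ∀ᶠ n in atTop, dist (f n t) o ≤ C)
    (hiso : ∀ s ∈ S, ∀ t ∈ S, ∀ᶠ n in atTop, dist (f n s) (f n t) = |s - t|) :
    ∃ g : ℝ → X, (∀ s ∈ S, ∀ t ∈ S, dist (g s) (g t) = |s - t|) ∧
      ∀ t ∈ S, Tendsto (fun n => f n t) (hyperfilter ℕ : Filter ℕ) (𝓝 (g t)) := by
  have hle : (hyperfilter ℕ : Filter ℕ) ≤ atTop := Nat.hyperfilter_le_atTop
  have key : ∀ t, ∃ y : X, t ∈ S →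
      Tendsto (fun n => f n t) (hyperfilter ℕ : Filter ℕ) (𝓝 y) := by
    intro t
    by_cases ht : t ∈ S
    · obtain ⟨C, hC⟩ := hb t ht
      obtain ⟨y, -, hy⟩ := (isCompact_closedBall o C).ultrafilter_le_nhds
        ((hyperfilter ℕ).map (fun n => f n t)) (by
          rw [Ultrafilter.coe_map, le_principal_iff]
          exact hle hC)
      exact ⟨y, fun _ => hy⟩
    · exact ⟨o, fun h => absurd h ht⟩
  choose g hg using key
  refine ⟨g, fun s hs t ht => ?_, hg⟩
  refine tendsto_nhds_unique ((hg s hs).dist (hg t ht)) ?_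
  exact tendsto_const_nhds.congr' (((hiso s hs t ht).filter_mono hle).mono fun n hn => hn.symm)

theorem IsRay.isClosed_image {X : Type*} [MetricSpace X] {r : ℝ → X} (hr : IsRay r)
    {K : Set ℝ} (hK : IsClosed K) (hK0 : K ⊆ Set.Ici 0) : IsClosed (r '' K) := by
  have : CompleteSpace K := hK.completeSpace_coe
  have hiso : Isometry (fun t : K => r t) := Isometry.of_dist_eq fun s t => by
    rw [hr s t (hK0 s.2) (hK0 t.2), Subtype.dist_eq, Real.dist_eq]
  have := hiso.isClosedEmbedding.isClosed_range
  rwa [Set.image_eq_range]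

theorem IsRay.exists_dist_eq_infDist {X : Type*} [MetricSpace X] [ProperSpace X] {r : ℝ → X}
    (hr : IsRay r) {K : Set ℝ} (hK : IsClosed K) (hK0 : K ⊆ Set.Ici 0) (hne : K.Nonempty)
    (x : X) : ∃ t ∈ K, infDist x (r '' K) = dist x (r t) := by
  obtain ⟨_, ⟨t, ht, rfl⟩, h⟩ :=
    (hr.isClosed_image hK hK0).exists_infDist_eq_dist (hne.image r) x
  exact ⟨t, ht, h⟩

theorem IsRay.exists_isNearestOnRay {X : Type*} [MetricSpace X] [ProperSpace X] {r : ℝ → X}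
    (hr : IsRay r) (x : X) : ∃ t, IsNearestOnRay r x t := by
  obtain ⟨t, ht, h⟩ := hr.exists_dist_eq_infDist isClosed_Ici subset_rfl ⟨0, le_refl (0 : ℝ)⟩ x
  exact ⟨t, ht, fun s hs => h ▸ infDist_le_dist_of_mem (Set.mem_image_of_mem r hs)⟩

theorem IsSegmentOn.continuousOn {X : Type*} [MetricSpace X] {l : ℝ → X} {a b : ℝ}
    (hl : IsSegmentOn l a b) : ContinuousOn l (Set.Icc a b) := by
  rw [Metric.continuousOn_iff]
  exact fun t ht ε hε => ⟨ε, hε, fun s hs h => by rwa [hl s hs t ht, ← Real.dist_eq]⟩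

namespace IsThinSpace

variable {X : Type*} [MetricSpace X] {R D : ℝ}

theorem dist_lt_of_isNearestOnRay (hX : IsThinSpace X R D) {r : ℝ → X} (hr : IsRay r) {x : X}
    {t : ℝ} (ht : IsNearestOnRay r x t) (hRt : R < t) : dist x (r t) < D := by
  have hR := hX.R_pos
  have hmem : r t ∈ r '' Set.Icc 0 (t + R + 1) :=
    Set.mem_image_of_mem r ⟨ht.1, by linarith⟩
  have heq : dist x (r t) = infDist x (r '' Set.Icc 0 (t + R + 1)) := by
    refine le_antisymm ((le_infDist ⟨_, hmem⟩).2 ?_) (infDist_le_dist_of_mem hmem)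
    rintro _ ⟨s, hs, rfl⟩
    exact ht.2 s hs.1
  rw [heq]
  exact hX.thin r (t + R + 1) (by linarith) (fun a ha b hb => hr a b ha.1 hb.1) t
    ⟨hRt, by linarith⟩ x heq

/-- A segment from a point projecting before `r c` to a point of the ray after `r c` passes
near `r c`. -/
theorem exists_dist_lt_of_segment (hX : IsThinSpace X R D) {r : ℝ → X} (hr : IsRay r)
    {x : X} {a c T : ℝ} (ha : IsNearestOnRay r x a) (hac : a ≤ c) (hRc : R < c) (hcT : c ≤ T)
    {l : ℝ → X} (hl : IsSegmentOn l 0 (dist x (r T))) (hl0 : l 0 = x)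
    (hl1 : l (dist x (r T)) = r T) :
    ∃ s ∈ Set.Icc 0 (dist x (r T)), dist (l s) (r c) < 3 * D := by
  have := hX.proper
  have hR := hX.R_pos
  have hc : 0 ≤ c := by linarith
  have hsub₁ : Set.Icc 0 c ⊆ Set.Ici (0 : ℝ) := fun t ht => ht.1
  have hsub₂ : Set.Ici c ⊆ Set.Ici (0 : ℝ) := Set.Ici_subset_Ici.2 hc
  have hcont : ContinuousOn
      (fun s => infDist (l s) (r '' Set.Icc 0 c) - infDist (l s) (r '' Set.Ici c))
      (Set.Icc 0 (dist x (r T))) :=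
    ((continuous_infDist_pt _).comp_continuousOn hl.continuousOn).sub
      ((continuous_infDist_pt _).comp_continuousOn hl.continuousOn)
  obtain ⟨s, hs, hs0⟩ := intermediate_value_Icc dist_nonneg hcont (a := 0) (show (0 : ℝ) ∈ _ from by
    constructor
    · rw [hl0, sub_nonpos]
      obtain ⟨b, hb, hb'⟩ := hr.exists_dist_eq_infDist isClosed_Ici hsub₂ ⟨c, le_refl c⟩ x
      rw [hb']
      have ha' : a ∈ Set.Icc 0 c := ⟨ha.1, hac⟩
      exact (infDist_le_dist_of_mem (Set.mem_image_of_mem r ha')).trans (ha.2 b (hsub₂ hb))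
    · rw [hl1, infDist_zero_of_mem (s := r '' Set.Ici c) (Set.mem_image_of_mem r hcT), sub_zero]
      exact infDist_nonneg)
  refine ⟨s, hs, ?_⟩
  obtain ⟨p, hp, hp'⟩ :=
    hr.exists_dist_eq_infDist isClosed_Icc hsub₁ ⟨c, hc, le_refl c⟩ (l s)
  obtain ⟨q, hq, hq'⟩ := hr.exists_dist_eq_infDist isClosed_Ici hsub₂ ⟨c, le_refl c⟩ (l s)
  have hpq : dist (l s) (r p) = dist (l s) (r q) := by
    rw [← hp', ← hq']; exact sub_eq_zero.1 hs0
  have hnear : IsNearestOnRay r (l s) q := by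
    refine ⟨hsub₂ hq, fun t ht => ?_⟩
    rcases le_total t c with htc | htc
    · rw [← hpq, ← hp']
      exact infDist_le_dist_of_mem (Set.mem_image_of_mem r ⟨ht, htc⟩)
    · rw [← hq']
      exact infDist_le_dist_of_mem (Set.mem_image_of_mem r htc)
  have hq0 : c ≤ q := hq
  have hD := hX.dist_lt_of_isNearestOnRay hr hnear (hRc.trans_le hq0)
  have h₁ := hr p q hp.1 (hsub₂ hq)
  have h₂ := hr q c (hsub₂ hq) hc
  rw [abs_of_nonneg (by linarith)] at h₂
  rw [abs_sub_comm, abs_of_nonneg (by linarith [hp.2])] at h₁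
  have h₃ := dist_triangle_left (r p) (r q) (l s)
  have h₄ := dist_triangle (l s) (r q) (r c)
  linarith [hp.2]

theorem dist_add_dist_lt (hX : IsThinSpace X R D) {r : ℝ → X} (hr : IsRay r)
    {x : X} {a c T : ℝ} (ha : IsNearestOnRay r x a) (hac : a ≤ c) (hRc : R < c) (hcT : c ≤ T) :
    dist x (r c) + (T - c) < dist x (r T) + 6 * D := by
  obtain ⟨l, hl, hl0, hl1⟩ := hX.geodesic x (r T)
  obtain ⟨s, hs, hsD⟩ := hX.exists_dist_lt_of_segment hr ha hac hRc hcT hl hl0 hl1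
  have hc : 0 ≤ c := by linarith [hX.R_pos]
  have h₁ := hl 0 ⟨le_rfl, dist_nonneg⟩ s hs
  have h₂ := hl s hs _ ⟨dist_nonneg, le_rfl⟩
  have h₃ := hr c T hc (hc.trans hcT)
  rw [abs_sub_comm, abs_of_nonneg (by linarith [hs.1]), hl0] at h₁
  rw [abs_sub_comm, abs_of_nonneg (by linarith [hs.2]), hl1] at h₂
  rw [abs_sub_comm, abs_of_nonneg (by linarith)] at h₃
  have h₄ := dist_triangle x (l s) (r c)
  have h₅ := dist_triangle_left (r c) (r T) (l s)
  linarith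

theorem exists_isRay (hX : IsThinSpace X R D) (hnc : ¬ IsCompact (Set.univ : Set X)) :
    ∃ r : ℝ → X, IsRay r := by
  have := hX.proper
  have hne : Nonempty X := by
    by_contra h
    rw [not_nonempty_iff] at h
    exact hnc (Set.univ_eq_empty_iff.2 h ▸ isCompact_empty)
  obtain ⟨o⟩ := hne
  have hfar : ∀ n : ℕ, ∃ x : X, (n : ℝ) < dist o x := by
    by_contra! h
    obtain ⟨n, hn⟩ := h
    refine hnc ((isCompact_closedBall o n).of_isClosed_subset isClosed_univ fun x _ => ?_)
    rw [mem_closedBall, dist_comm]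
    exact hn x
  choose x hx using hfar
  choose f hf hf0 hf1 using fun n => hX.geodesic o (x n)
  have hiso : ∀ s ∈ Set.Ici (0 : ℝ), ∀ t ∈ Set.Ici (0 : ℝ),
      ∀ᶠ n in atTop, dist (f n s) (f n t) = |s - t| := by
    intro s hs t ht
    filter_upwards [tendsto_natCast_atTop_atTop.eventually_ge_atTop s,
      tendsto_natCast_atTop_atTop.eventually_ge_atTop t] with n hns hnt
    exact hf n s ⟨hs, by linarith [hx n]⟩ t ⟨ht, by linarith [hx n]⟩
  obtain ⟨g, hg, -⟩ := exists_isometric_ultralimit f o (Set.Ici 0) (fun t ht =>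
    ⟨|t - 0|, (hiso t ht 0 (le_refl (0 : ℝ))).mono fun n hn => by rw [← hn, hf0]⟩) hiso
  exact ⟨g, fun s t hs ht => hg s hs t ht⟩

/-- Without lines, the points projecting to an initial part of a ray form a bounded set. -/
theorem exists_forall_dist_le (hX : IsThinSpace X R D)
    (hnl : ¬ ∃ f : ℝ → X, ∀ s t : ℝ, dist (f s) (f t) = |s - t|)
    {r : ℝ → X} (hr : IsRay r) {c : ℝ} (hRc : R < c) :
    ∃ C, ∀ x a, IsNearestOnRay r x a → a ≤ c → dist x (r c) ≤ C := by
  have := hX.proper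
  have hc : 0 ≤ c := by linarith [hX.R_pos]
  by_contra! h
  choose x a ha hac hx using fun n : ℕ => h n
  choose l hl hl0 hl1 using fun n : ℕ => hX.geodesic (x n) (r (c + n))
  choose s hs hsD using fun n : ℕ => hX.exists_dist_lt_of_segment hr (ha n) (hac n) hRc
    (le_add_of_nonneg_right n.cast_nonneg) (hl n) (hl0 n) (hl1 n)
  have hdom : ∀ t : ℝ, ∀ᶠ n : ℕ in atTop, s n + t ∈ Set.Icc 0 (dist (x n) (r (c + n))) := by
    intro t
    filter_upwards [tendsto_natCast_atTop_atTop.eventually_ge_atTop (|t| + 3 * D)] with n hn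
    have h₁ := hl n 0 ⟨le_rfl, dist_nonneg⟩ (s n) (hs n)
    have h₂ := hl n (s n) (hs n) _ ⟨dist_nonneg, le_rfl⟩
    have h₃ := hr c (c + n) hc (by positivity)
    rw [abs_sub_comm, abs_of_nonneg (by linarith [(hs n).1]), hl0] at h₁
    rw [abs_sub_comm, abs_of_nonneg (by linarith [(hs n).2]), hl1] at h₂
    rw [abs_sub_comm, abs_of_nonneg (by simp)] at h₃
    have h₄ := dist_triangle (x n) (l n (s n)) (r c)
    have h₅ := dist_triangle_left (r c) (r (c + n)) (l n (s n))
    have h₆ := neg_abs_le t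
    have h₇ := le_abs_self t
    constructor <;> linarith [hx n, hsD n]
  have hiso : ∀ p ∈ Set.univ, ∀ q ∈ Set.univ,
      ∀ᶠ n in atTop, dist (l n (s n + p)) (l n (s n + q)) = |p - q| := by
    intro p _ q _
    filter_upwards [hdom p, hdom q] with n hp hq
    rw [hl n _ hp _ hq, add_sub_add_left_eq_sub]
  obtain ⟨g, hg, -⟩ := exists_isometric_ultralimit (fun n t => l n (s n + t)) (r c) Set.univ
    (fun t ht => ⟨|t - 0| + 3 * D, (hiso t ht 0 trivial).mono fun n hn => by
      rw [← hn, add_zero]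
      exact (dist_triangle _ _ _).trans (add_le_add_right (hsD n).le _)⟩) hiso
  exact hnl ⟨g, fun p q => hg p trivial q trivial⟩

/-- From every point starts a ray that follows a given ray `r`. -/
theorem exists_isRay_near (hX : IsThinSpace X R D) {r : ℝ → X} (hr : IsRay r) {p : X} {a : ℝ}
    (ha : IsNearestOnRay r p a) :
    ∃ ρ : ℝ → X, IsRay ρ ∧
      ∀ c, a ≤ c → R < c → dist (ρ (dist p (r c))) (r c) ≤ 6 * D := by
  have := hX.proper
  choose l hl hl0 hl1 using fun n : ℕ => hX.geodesic p (r n)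
  have hdom : ∀ t ∈ Set.Ici (0 : ℝ), ∀ᶠ n : ℕ in atTop, t ∈ Set.Icc 0 (dist p (r n)) := by
    intro t ht
    filter_upwards [tendsto_natCast_atTop_atTop.eventually_ge_atTop (t + dist p (r 0))] with n hn
    have h₁ := hr 0 n le_rfl n.cast_nonneg
    rw [abs_sub_comm, sub_zero, abs_of_nonneg n.cast_nonneg] at h₁
    have h₂ := dist_triangle_left (r 0) (r n) p
    exact ⟨ht, by linarith⟩
  have hiso : ∀ s ∈ Set.Ici (0 : ℝ), ∀ t ∈ Set.Ici (0 : ℝ),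
      ∀ᶠ n in atTop, dist (l n s) (l n t) = |s - t| := by
    intro s hs t ht
    filter_upwards [hdom s hs, hdom t ht] with n hns hnt
    exact hl n s hns t hnt
  obtain ⟨g, hg, hlim⟩ := exists_isometric_ultralimit l p (Set.Ici 0) (fun t ht =>
    ⟨|t - 0|, (hiso t ht 0 (le_refl (0 : ℝ))).mono fun n hn => by rw [← hn, hl0]⟩) hiso
  refine ⟨g, fun s t hs ht => hg s hs t ht, fun c hac hRc => ?_⟩
  have hu : dist p (r c) ∈ Set.Ici (0 : ℝ) := dist_nonneg
  refine le_of_tendsto ((hlim _ hu).dist tendsto_const_nhds)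
    (Nat.hyperfilter_le_atTop ?_)
  filter_upwards [hdom _ hu, tendsto_natCast_atTop_atTop.eventually_ge_atTop c] with n hn hcn
  obtain ⟨s, hs, hsD⟩ :=
    hX.exists_dist_lt_of_segment hr ha hac hRc hcn (hl n) (hl0 n) (hl1 n)
  have h₁ := hl n 0 ⟨le_rfl, dist_nonneg⟩ s hs
  rw [abs_sub_comm, sub_zero, abs_of_nonneg hs.1, hl0] at h₁
  have h₂ : |dist p (r c) - s| ≤ dist (l n s) (r c) := by
    have h := abs_dist_sub_le (r c) (l n s) p
    rwa [dist_comm _ p, dist_comm _ p, h₁, dist_comm (r c)] at h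
  have h₃ := hl n _ hn s hs
  linarith [dist_triangle (l n (dist p (r c))) (l n s) (r c)]

end IsThinSpace

/-- Proposition 4.11: a non-compact `(R,D)`-thin metric space
containing no line is contained in the `10R`-neighbourhood of some ray. -/
theorem thin_noncompact_no_line_near_ray
    {X : Type*} [MetricSpace X] {R D : ℝ} (hX : IsThinSpace X R D)
    (hnc : ¬ IsCompact (Set.univ : Set X))
    (hnl : ¬ ∃ f : ℝ → X, ∀ s t : ℝ, dist (f s) (f t) = |s - t|) :
    ∃ r : ℝ → X, IsRay r ∧ ∀ x : X, Metric.infDist x (r '' Set.Ici 0) < 10 * R := by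
  have := hX.proper
  have hR := hX.R_pos
  have hD := hX.D_pos
  have hRD := hX.twentyD_le_R
  have h2R : R < 2 * R := by linarith
  obtain ⟨r, hr⟩ := hX.exists_isRay hnc
  obtain ⟨C, hC⟩ := hX.exists_forall_dist_le hnl hr h2R
  set S : Set ℝ := {d | ∃ x a, IsNearestOnRay r x a ∧ a ≤ 2 * R ∧ dist x (r (2 * R)) = d}
  have hS : BddAbove S := ⟨C, by rintro _ ⟨x, a, ha, hac, rfl⟩; exact hC x a ha hac⟩
  have hne : S.Nonempty := ⟨_, r 0, 0, ⟨le_rfl, fun s _ => by simp⟩, by linarith, rfl⟩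
  obtain ⟨_, ⟨p, a, ha, hac, rfl⟩, hp⟩ := exists_lt_of_lt_csSup hne (sub_lt_self (sSup S) hD)
  have hmax : ∀ x b, IsNearestOnRay r x b → b ≤ 2 * R →
      dist x (r (2 * R)) ≤ dist p (r (2 * R)) + D := fun x b hb hbR => by
    linarith [le_csSup hS ⟨x, b, hb, hbR, rfl⟩]
  obtain ⟨ρ, hρ, hnear⟩ := hX.exists_isRay_near hr ha
  refine ⟨ρ, hρ, fun x => ?_⟩
  suffices h : ∃ t, 0 ≤ t ∧ dist x (ρ t) < 10 * R by
    obtain ⟨t, ht, h⟩ := h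
    exact (infDist_le_dist_of_mem (Set.mem_image_of_mem ρ ht)).trans_lt h
  obtain ⟨b, hb⟩ := hr.exists_isNearestOnRay x
  rcases le_total b (2 * R) with hbR | hbR
  · obtain ⟨s, hs⟩ := hρ.exists_isNearestOnRay x
    rcases lt_or_ge R s with hsR | hsR
    · exact ⟨s, hs.1, by linarith [hX.dist_lt_of_isNearestOnRay hρ hs hsR]⟩
    have hx := hmax x b hb hbR
    have hu := hnear (2 * R) hac h2R
    have htri := dist_triangle_right x (ρ (dist p (r (2 * R)))) (r (2 * R))
    rcases le_total (2 * R) (dist p (r (2 * R))) with hM | hM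
    · have := hX.dist_add_dist_lt hρ hs (by linarith) h2R hM
      exact ⟨2 * R, by linarith, by linarith⟩
    · exact ⟨_, dist_nonneg, by linarith⟩
  · have hbD := hX.dist_lt_of_isNearestOnRay hr hb (by linarith)
    have hu := hnear b (hac.trans hbR) (by linarith)
    exact ⟨_, dist_nonneg, by linarith [dist_triangle_right x (ρ (dist p (r b))) (r b)]⟩
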